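/- arXiv:2504.02669 — 3 statements merged into one kernel-verified Lean document; each statement's English description precedes it below -/
import Mathlib

section
/- There exists a constant C > 0 such that the following holds. Let k be a nonzero integer, δ₀ > 0, and let U : [-1,1] → ℝ be three times continuously differentiable with |U''(y)| ≤ δ₀ and |U'''(y)| ≤ δ₀ for all y ∈ [-1,1]. Define K₁(y,y') := (y-y')·U''(y)·G_k(y,y'). Then the partial derivatives ∂_y K₁ and ∂_{y'} K₁, defined for y ≠ y', satisfy (∬_{[-1,1]²} |∂_y K₁(y,y')|² dy dy')^{1/2} + (∬_{[-1,1]²} |∂_{y'} K₁(y,y')|² dy dy')^{1/2} ≤ C·δ₀/|k|. -/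
open Set

noncomputable def Gk (k : ℤ) (y y' : ℝ) : ℝ :=
  if y ≤ y' then
    -(Real.sinh ((k : ℝ) * (1 - y')) * Real.sinh ((k : ℝ) * (1 + y))) /
      ((k : ℝ) * Real.sinh (2 * (k : ℝ)))
  else
    -(Real.sinh ((k : ℝ) * (1 - y)) * Real.sinh ((k : ℝ) * (1 + y'))) /
      ((k : ℝ) * Real.sinh (2 * (k : ℝ)))

lemma abs_sinh_mul_le_exp (κ : ℝ) {u : ℝ} (hu : 0 ≤ u) :
    |Real.sinh (κ * u)| ≤ Real.exp (|κ| * u) := by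
  rw [Real.abs_sinh, abs_mul, abs_of_nonneg hu, Real.sinh_eq]
  linarith [Real.exp_pos (|κ| * u), Real.exp_pos (-(|κ| * u))]

lemma abs_cosh_mul_le_exp (κ : ℝ) {u : ℝ} (hu : 0 ≤ u) :
    |Real.cosh (κ * u)| ≤ Real.exp (|κ| * u) := by
  rw [abs_of_pos (Real.cosh_pos _), ← Real.cosh_abs, abs_mul, abs_of_nonneg hu, Real.cosh_eq]
  have : Real.exp (-(|κ| * u)) ≤ Real.exp (|κ| * u) := by
    apply Real.exp_le_exp.mpr
    have : 0 ≤ |κ| * u := by positivity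
    linarith
  linarith

lemma exp_div_four_le_abs_sinh {κ : ℝ} (hκ : 1 ≤ |κ|) :
    Real.exp (|κ| * 2) / 4 ≤ |Real.sinh (2 * κ)| := by
  rw [Real.abs_sinh, abs_mul, abs_two, mul_comm 2, Real.sinh_eq]
  have h₁ : Real.exp (-(|κ| * 2)) ≤ 1 := Real.exp_le_one_iff.mpr (by linarith)
  have h₂ := Real.add_one_le_exp (|κ| * 2)
  linarith

/-- Two factors of exponential growth `p` and `q` with `p + q = 2 - d` divided by `sinh (2 κ)`
decay exponentially in `d`. -/
lemma abs_mul_div_sinh_le {κ A B p q d : ℝ} (hκ : 1 ≤ |κ|)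
    (hA : |A| ≤ Real.exp (|κ| * p)) (hB : |B| ≤ Real.exp (|κ| * q)) (hd : p + q = 2 - d) :
    |A * B / Real.sinh (2 * κ)| ≤ 4 * Real.exp (-(|κ| * d)) := by
  have hs := exp_div_four_le_abs_sinh hκ
  have hpos : 0 < |Real.sinh (2 * κ)| := lt_of_lt_of_le (by positivity) hs
  rw [abs_div, abs_mul, div_le_iff₀ hpos]
  calc |A| * |B| ≤ Real.exp (|κ| * p) * Real.exp (|κ| * q) := by gcongr
    _ = 4 * Real.exp (-(|κ| * d)) * (Real.exp (|κ| * 2) / 4) := by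
      rw [← Real.exp_add, ← mul_add, hd, mul_div_assoc', mul_assoc, ← Real.exp_add,
        mul_div_cancel_left₀ _ (by norm_num)]
      ring_nf
    _ ≤ _ := by gcongr

lemma mul_exp_neg_mul_le {a : ℝ} (ha : 0 < a) (d : ℝ) : d * Real.exp (-(a * d)) ≤ 1 / a := by
  rw [le_div_iff₀ ha, Real.exp_neg]
  have h := Real.add_one_le_exp (a * d)
  have hpos := Real.exp_pos (a * d)
  rw [mul_right_comm, ← div_eq_mul_inv, div_le_one hpos]
  linarith

lemma one_le_abs_intCast {k : ℤ} (hk : k ≠ 0) : 1 ≤ |(k : ℝ)| := by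
  exact_mod_cast Int.one_le_abs hk

lemma Gk_comm (k : ℤ) (y y' : ℝ) : Gk k y y' = Gk k y' y := by
  unfold Gk
  rcases lt_trichotomy y y' with h | rfl | h
  · rw [if_pos h.le, if_neg h.not_ge]
  · rfl
  · rw [if_neg h.not_ge, if_pos h.le]

lemma abs_Gk_le_of_le {k : ℤ} (hk : k ≠ 0) {y y' : ℝ} (hy : y ∈ Icc (-1 : ℝ) 1)
    (hy' : y' ∈ Icc (-1 : ℝ) 1) (h : y ≤ y') : |Gk k y y'| ≤ 4 / |(k : ℝ)| := by
  have hk1 := one_le_abs_intCast hk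
  have hb := abs_mul_div_sinh_le hk1
    (abs_sinh_mul_le_exp (k : ℝ) (sub_nonneg.mpr hy'.2))
    (abs_sinh_mul_le_exp (k : ℝ) (u := 1 + y) (by linarith [hy.1]))
    (d := y' - y) (by ring)
  have he : Real.exp (-(|(k : ℝ)| * (y' - y))) ≤ 1 := by
    apply Real.exp_le_one_iff.mpr
    have : 0 ≤ |(k : ℝ)| * (y' - y) := mul_nonneg (abs_nonneg _) (sub_nonneg.mpr h)
    linarith
  rw [Gk, if_pos h, mul_comm (k : ℝ) (Real.sinh _), ← div_div, abs_div, neg_div, abs_neg]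
  gcongr
  linarith

lemma abs_Gk_le {k : ℤ} (hk : k ≠ 0) {y y' : ℝ} (hy : y ∈ Icc (-1 : ℝ) 1)
    (hy' : y' ∈ Icc (-1 : ℝ) 1) : |Gk k y y'| ≤ 4 / |(k : ℝ)| := by
  rcases le_total y y' with h | h
  · exact abs_Gk_le_of_le hk hy hy' h
  · rw [Gk_comm]
    exact abs_Gk_le_of_le hk hy' hy h

/-- Off the diagonal, `Gk` is differentiable in its first variable, and the derivative times the
distance to the diagonal is `O(1 / |k|)`. -/
lemma exists_hasDerivAt_Gk {k : ℤ} (hk : k ≠ 0) {y y' : ℝ} (hy : y ∈ Icc (-1 : ℝ) 1)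
    (hy' : y' ∈ Icc (-1 : ℝ) 1) (hne : y ≠ y') :
    ∃ g, HasDerivAt (fun z => Gk k z y') g y ∧ |y - y'| * |g| ≤ 4 / |(k : ℝ)| := by
  have hk1 := one_le_abs_intCast hk
  have hk0 : (k : ℝ) ≠ 0 := by exact_mod_cast hk
  have hexp (d : ℝ) (g : ℝ) (hd : 0 ≤ d) (hg : |g| ≤ 4 * Real.exp (-(|(k : ℝ)| * d))) :
      d * |g| ≤ 4 / |(k : ℝ)| := by
    have h₁ := mul_exp_neg_mul_le (by linarith : 0 < |(k : ℝ)|) d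
    have h₂ := mul_le_mul_of_nonneg_left hg hd
    have h₃ : 4 / |(k : ℝ)| = 4 * (1 / |(k : ℝ)|) := by ring
    linarith
  have hs0 : Real.sinh (2 * (k : ℝ)) ≠ 0 := by
    rw [Ne, Real.sinh_eq_zero]
    simpa using hk
  rcases hne.lt_or_gt with h | h
  · refine ⟨-(Real.sinh (k * (1 - y')) * Real.cosh (k * (1 + y)) / Real.sinh (2 * (k : ℝ))),
      ?_, ?_⟩
    · have hd : HasDerivAt (fun z : ℝ => -(Real.sinh ((k : ℝ) * (1 - y')) *
          Real.sinh ((k : ℝ) * (1 + z))) / ((k : ℝ) * Real.sinh (2 * (k : ℝ)))) _ y :=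
        (((((hasDerivAt_id y).const_add 1).const_mul (k : ℝ)).sinh.const_mul
          (Real.sinh ((k : ℝ) * (1 - y')))).neg).div_const _
      refine (hd.congr_of_eventuallyEq ?_).congr_deriv ?_
      · filter_upwards [Iio_mem_nhds h] with z hz
        rw [Gk, if_pos (le_of_lt hz)]
      · simp only [id]
        field_simp
    · rw [abs_sub_comm, abs_of_pos (sub_pos.mpr h)]
      refine hexp _ _ (sub_pos.mpr h).le ?_
      rw [abs_neg]
      exact abs_mul_div_sinh_le hk1 (abs_sinh_mul_le_exp _ (sub_nonneg.mpr hy'.2))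
        (abs_cosh_mul_le_exp _ (by linarith [hy.1])) (by ring)
  · refine ⟨Real.cosh (k * (1 - y)) * Real.sinh (k * (1 + y')) / Real.sinh (2 * (k : ℝ)),
      ?_, ?_⟩
    · have hd : HasDerivAt (fun z : ℝ => -(Real.sinh ((k : ℝ) * (1 - z)) *
          Real.sinh ((k : ℝ) * (1 + y'))) / ((k : ℝ) * Real.sinh (2 * (k : ℝ)))) _ y :=
        (((((hasDerivAt_id y).const_sub 1).const_mul (k : ℝ)).sinh.mul_const
          (Real.sinh ((k : ℝ) * (1 + y')))).neg).div_const _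
      refine (hd.congr_of_eventuallyEq ?_).congr_deriv ?_
      · filter_upwards [Ioi_mem_nhds h] with z hz
        rw [Gk, if_neg (not_le.mpr hz)]
      · simp only [id]
        field_simp
    · rw [abs_of_pos (sub_pos.mpr h)]
      refine hexp _ _ (sub_pos.mpr h).le ?_
      exact abs_mul_div_sinh_le hk1 (abs_cosh_mul_le_exp _ (sub_nonneg.mpr hy.2))
        (abs_sinh_mul_le_exp _ (by linarith [hy'.1])) (by ring)

lemma abs_sub_le_two {y y' : ℝ} (hy : y ∈ Icc (-1 : ℝ) 1) (hy' : y' ∈ Icc (-1 : ℝ) 1) :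
    |y - y'| ≤ 2 := by
  rw [abs_le]
  constructor <;> linarith [hy.1, hy.2, hy'.1, hy'.2]

lemma abs_deriv_fst_kernel_le {k : ℤ} (hk : k ≠ 0) {δ : ℝ} {V : ℝ → ℝ} {y y' : ℝ}
    (hy : y ∈ Icc (-1 : ℝ) 1) (hy' : y' ∈ Icc (-1 : ℝ) 1) (hne : y ≠ y')
    (hV : DifferentiableAt ℝ V y) (hV₀ : |V y| ≤ δ) (hV₁ : |deriv V y| ≤ δ) :
    |deriv (fun z => (z - y') * V z * Gk k z y') y| ≤ 16 * δ / |(k : ℝ)| := by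
  obtain ⟨g, hg, hgb⟩ := exists_hasDerivAt_Gk hk hy hy' hne
  have hG := abs_Gk_le hk hy hy'
  have hd : HasDerivAt (fun z => (z - y') * V z * Gk k z y')
      ((1 * V y + (y - y') * deriv V y) * Gk k y y' + (y - y') * V y * g) y :=
    (((hasDerivAt_id y).sub_const y').mul hV.hasDerivAt).mul hg
  have hδ : 0 ≤ δ := (abs_nonneg _).trans hV₀
  rw [hd.deriv]
  calc _ ≤ (|V y| + |y - y'| * |deriv V y|) * |Gk k y y'| + |V y| * (|y - y'| * |g|) := by
        refine (abs_add_le _ _).trans ?_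
        rw [abs_mul, abs_mul, abs_mul, one_mul, mul_comm |y - y'| |V y|, mul_assoc]
        gcongr
        refine (abs_add_le _ _).trans ?_
        rw [abs_mul]
    _ ≤ (δ + 2 * δ) * (4 / |(k : ℝ)|) + δ * (4 / |(k : ℝ)|) := by
        have := abs_sub_le_two hy hy'
        gcongr
    _ = 16 * δ / |(k : ℝ)| := by ring

lemma abs_deriv_snd_kernel_le {k : ℤ} (hk : k ≠ 0) {δ v y y' : ℝ}
    (hy : y ∈ Icc (-1 : ℝ) 1) (hy' : y' ∈ Icc (-1 : ℝ) 1) (hne : y ≠ y') (hv : |v| ≤ δ) :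
    |deriv (fun w => (y - w) * v * Gk k y w) y'| ≤ 8 * δ / |(k : ℝ)| := by
  obtain ⟨g, hg, hgb⟩ := exists_hasDerivAt_Gk hk hy' hy hne.symm
  have hG := abs_Gk_le hk hy hy'
  simp only [← Gk_comm k y] at hg
  have hd : HasDerivAt (fun w => (y - w) * v * Gk k y w)
      (-1 * v * Gk k y y' + (y - y') * v * g) y' :=
    (((hasDerivAt_id y').const_sub y).mul_const v).mul hg
  have hδ : 0 ≤ δ := (abs_nonneg _).trans hv
  rw [hd.deriv]
  rw [abs_sub_comm] at hgb
  calc _ ≤ |v| * |Gk k y y'| + |v| * (|y - y'| * |g|) := by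
        refine (abs_add_le _ _).trans (le_of_eq ?_)
        simp only [abs_mul, abs_neg, abs_one]
        ring
    _ ≤ δ * (4 / |(k : ℝ)|) + δ * (4 / |(k : ℝ)|) := by gcongr
    _ = 8 * δ / |(k : ℝ)| := by ring

/-- The `L²` norm over the square `[-1, 1]²` of a function bounded by `B` off the diagonal is at
most `2 B`. -/
lemma sqrt_integral_sq_le {F : ℝ → ℝ → ℝ} {B : ℝ} (hB : 0 ≤ B)
    (hF : ∀ y ∈ Ioo (-1 : ℝ) 1, ∀ y' ∈ Icc (-1 : ℝ) 1, y ≠ y' → |F y y'| ≤ B) :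
    Real.sqrt (∫ y in (-1 : ℝ)..1, ∫ y' in (-1 : ℝ)..1, (F y y') ^ 2) ≤ 2 * B := by
  have inner (y : ℝ) (hy : y ∈ Ioo (-1 : ℝ) 1) :
      ‖∫ y' in (-1 : ℝ)..1, (F y y') ^ 2‖ ≤ B ^ 2 * |1 - (-1 : ℝ)| := by
    apply intervalIntegral.norm_integral_le_of_norm_le_const_ae
    filter_upwards [MeasureTheory.Measure.ae_ne MeasureTheory.volume y] with y' hne hy'
    rw [uIoc_of_le (by norm_num)] at hy'
    rw [norm_pow, Real.norm_eq_abs]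
    gcongr
    exact hF y hy y' (Ioc_subset_Icc_self hy') hne.symm
  have outer : ‖∫ y in (-1 : ℝ)..1, ∫ y' in (-1 : ℝ)..1, (F y y') ^ 2‖
      ≤ B ^ 2 * |1 - (-1 : ℝ)| * |1 - (-1 : ℝ)| := by
    apply intervalIntegral.norm_integral_le_of_norm_le_const_ae
    filter_upwards [MeasureTheory.Measure.ae_ne MeasureTheory.volume (1 : ℝ)] with y hne hy
    rw [uIoc_of_le (by norm_num)] at hy
    exact inner y ⟨hy.1, lt_of_le_of_ne hy.2 hne⟩
  rw [Real.sqrt_le_left (by positivity)]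
  refine (le_abs_self _).trans (outer.trans (le_of_eq ?_))
  norm_num
  ring

theorem stmt_7 :
    ∃ C : ℝ, 0 < C ∧ ∀ k : ℤ, k ≠ 0 → ∀ δ₀ : ℝ, 0 < δ₀ → ∀ U : ℝ → ℝ,
      ContDiffOn ℝ 3 U (Icc (-1) 1) →
      (∀ y ∈ Icc (-1:ℝ) 1, |deriv (deriv U) y| ≤ δ₀) →
      (∀ y ∈ Icc (-1:ℝ) 1, |deriv (deriv (deriv U)) y| ≤ δ₀) →
      Real.sqrt (∫ y in (-1:ℝ)..1, ∫ y' in (-1:ℝ)..1,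
          (deriv (fun z => (z - y') * deriv (deriv U) z * Gk k z y') y)^2)
        + Real.sqrt (∫ y in (-1:ℝ)..1, ∫ y' in (-1:ℝ)..1,
          (deriv (fun w => (y - w) * deriv (deriv U) y * Gk k y w) y')^2)
        ≤ C * δ₀ / |(k : ℝ)| := by
  refine ⟨48, by norm_num, fun k hk δ₀ hδ U hU hU₂ hU₃ => ?_⟩
  have hV : ContDiffOn ℝ 1 (deriv (deriv U)) (Ioo (-1) 1) :=
    ((hU.mono Ioo_subset_Icc_self).deriv_of_isOpen (m := 2) isOpen_Ioo
      (by norm_num)).deriv_of_isOpen isOpen_Ioo (by norm_num)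
  have h₁ := sqrt_integral_sq_le (B := 16 * δ₀ / |(k : ℝ)|)
    (F := fun y y' => deriv (fun z => (z - y') * deriv (deriv U) z * Gk k z y') y)
    (by positivity) fun y hy y' hy' hne =>
      have hyc := Ioo_subset_Icc_self hy
      abs_deriv_fst_kernel_le hk hyc hy' hne
        ((hV.contDiffAt (isOpen_Ioo.mem_nhds hy)).differentiableAt (by norm_num))
        (hU₂ y hyc) (hU₃ y hyc)
  have h₂ := sqrt_integral_sq_le (B := 8 * δ₀ / |(k : ℝ)|)
    (F := fun y y' => deriv (fun w => (y - w) * deriv (deriv U) y * Gk k y w) y')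
    (by positivity) fun y hy y' hy' hne =>
      have hyc := Ioo_subset_Icc_self hy
      abs_deriv_snd_kernel_le hk hyc hy' hne (hU₂ y hyc)
  refine (add_le_add h₁ h₂).trans (le_of_eq ?_)
  ring
end

section
/- There exists a constant C₀ > 0 such that the following holds. Let μ ∈ (0,1], δ₀ ∈ (0,1/2), δ* > 0, and let k be a nonzero integer. Let U : [0,∞) × [-1,1] → ℝ be smooth with |∂_y³ U(t,y)| ≤ δ₀ for all t ≥ 0, y ∈ [-1,1]. Let ω, ψ, θ : [0,∞) × [-1,1] → ℂ be smooth with ω(t,±1) = 0 and ψ(t,±1) = 0 for all t ≥ 0, satisfying ∂_y² ψ - k²·ψ = ω and ∂_t ω + i·k·U·ω - i·k·(∂_y² U)·ψ - μ·∂_y² ω = -i·k·θ on [0,∞) × [-1,1]. Then for every t ≥ 0: (1/2)·(d/dt)‖ω(t,·)‖²_{L²} + μ·‖∂_y ω(t,·)‖²_{L²} ≤ C₀·δ₀·|k|·(k²·‖ψ(t,·)‖²_{L²} + ‖∂_y ψ(t,·)‖²_{L²}) + δ*·μ^{1/3}·|k|^{2/3}·‖ω(t,·)‖²_{L²} + (1/(4·δ*))·μ^{-1/3}·|k|^{4/3}·‖θ(t,·)‖²_{L²}.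 -/
open Set

theorem DifferentiableAt.hasDerivAt_uncurry_left {E : Type*} [NormedAddCommGroup E]
    [NormedSpace ℝ E] {f : ℝ → ℝ → E} {s y : ℝ}
    (hf : DifferentiableAt ℝ (Function.uncurry f) (s, y)) :
    HasDerivAt (fun s => f s y) (fderiv ℝ (Function.uncurry f) (s, y) (1, 0)) s :=
  HasFDerivAt.comp_hasDerivAt (l := Function.uncurry f) (f := fun s => (s, y)) s hf.hasFDerivAt
    ((hasDerivAt_id s).prodMk (hasDerivAt_const s y))

/-- Differentiation under the integral sign for a jointly `C¹` integrand. -/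
theorem hasDerivAt_intervalIntegral_of_contDiff {f : ℝ → ℝ → ℝ} {a b : ℝ}
    (hf : ContDiff ℝ 1 (Function.uncurry f)) (t : ℝ) :
    HasDerivAt (fun s => ∫ y in a..b, f s y) (∫ y in a..b, deriv (fun s => f s y) t) t := by
  have hderiv : ∀ s y, HasDerivAt (fun s => f s y)
      (fderiv ℝ (Function.uncurry f) (s, y) (1, 0)) s := fun s y =>
    (hf.differentiable one_ne_zero (s, y)).hasDerivAt_uncurry_left
  have hcont : Continuous fun p : ℝ × ℝ => fderiv ℝ (Function.uncurry f) p (1, 0) :=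
    (hf.continuous_fderiv one_ne_zero).clm_apply continuous_const
  obtain ⟨C, hC⟩ := ((isCompact_closedBall t 1).prod (isCompact_uIcc (a := a) (b := b))
    ).exists_bound_of_continuousOn hcont.continuousOn
  simp_rw [fun y => (hderiv t y).deriv]
  refine (intervalIntegral.hasDerivAt_integral_of_dominated_loc_of_deriv_le
    (F := f) (F' := fun s y => fderiv ℝ (Function.uncurry f) (s, y) (1, 0))
    (bound := fun _ => C) (Metric.closedBall_mem_nhds t one_pos) ?_ ?_ ?_ ?_ ?_ ?_).2
  · exact .of_forall fun s => (hf.continuous.comp (.prodMk_right s)).aestronglyMeasurable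
  · exact (hf.continuous.comp (.prodMk_right t)).intervalIntegrable a b
  · exact (hcont.comp (.prodMk_right t)).aestronglyMeasurable
  · exact .of_forall fun y hy s hs => hC (s, y) ⟨hs, uIoc_subset_uIcc hy⟩
  · exact intervalIntegrable_const
  · exact .of_forall fun y _ s _ => hderiv s y

/-- The pointwise form of the vorticity energy inequality: up to the `y`-derivative of
`μ Re(ω̄ ω') + k U'' Re(ψ̄' i ψ)`, the energy production is controlled by the stream function,
the vorticity and the forcing. -/
theorem vorticity_energy_pointwise {μ δ A B k u u₂ u₃ : ℝ} {w wt w₁ w₂ p p₁ p₂ θ : ℂ}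
    (hA : 0 < A) (hAB : 4 * (A * B) = k ^ 2) (hk : 1 ≤ k ^ 2) (hu : |u₃| ≤ δ)
    (hp : p₂ - (k : ℂ) ^ 2 * p = w)
    (hw : wt + Complex.I * k * u * w - Complex.I * k * u₂ * p - μ * w₂ = -(Complex.I * k * θ)) :
    (1 / 2) * (2 * inner ℝ w wt) + μ * ‖w₁‖ ^ 2 ≤
      (μ * (inner ℝ w w₂ + inner ℝ w₁ w₁) + (k * u₃ * inner ℝ p₁ (Complex.I * p) +
        k * u₂ * (inner ℝ p₁ (Complex.I * p₁) + inner ℝ p₂ (Complex.I * p)))) +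
      (1 * δ * |k| * (k ^ 2 * ‖p‖ ^ 2 + ‖p₁‖ ^ 2) + A * ‖w‖ ^ 2 + B * ‖θ‖ ^ 2) := by
  have hwt : wt = -(Complex.I * k * θ) - Complex.I * k * u * w + Complex.I * k * u₂ * p
      + μ * w₂ := by linear_combination hw
  have hp₂ : p₂ = w + (k : ℂ) ^ 2 * p := by linear_combination hp
  have hforce : -(k * inner ℝ w (Complex.I * θ)) ≤ A * ‖w‖ ^ 2 + B * ‖θ‖ ^ 2 := by
    have h := abs_real_inner_le_norm w (Complex.I * θ)
    rw [norm_mul, Complex.norm_I, one_mul] at h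
    have h' : -(k * inner ℝ w (Complex.I * θ)) ≤ |k| * (‖w‖ * ‖θ‖) := by
      refine (neg_le_abs _).trans ?_
      rw [abs_mul]
      gcongr
    refine h'.trans (le_of_mul_le_mul_left ?_ (by positivity : 0 < 4 * A))
    nlinarith [sq_nonneg (2 * A * ‖w‖ - |k| * ‖θ‖), sq_abs k]
  have hshear : -(k * u₃ * inner ℝ p₁ (Complex.I * p)) ≤
      1 * δ * |k| * (k ^ 2 * ‖p‖ ^ 2 + ‖p₁‖ ^ 2) := by
    have h := abs_real_inner_le_norm p₁ (Complex.I * p)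
    rw [norm_mul, Complex.norm_I, one_mul] at h
    have hyoung : ‖p₁‖ * ‖p‖ ≤ k ^ 2 * ‖p‖ ^ 2 + ‖p₁‖ ^ 2 := by
      nlinarith [sq_nonneg (‖p₁‖ - ‖p‖), mul_le_mul_of_nonneg_right hk (sq_nonneg ‖p‖),
        sq_nonneg ‖p₁‖, sq_nonneg ‖p‖]
    calc -(k * u₃ * inner ℝ p₁ (Complex.I * p))
        ≤ |k| * |u₃| * |inner ℝ p₁ (Complex.I * p)| := by
          rw [← abs_mul, ← abs_mul]; exact neg_le_abs _
      _ ≤ |k| * δ * (k ^ 2 * ‖p‖ ^ 2 + ‖p₁‖ ^ 2) := by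
          have := (abs_nonneg _).trans hu
          gcongr
          exact h.trans hyoung
      _ = _ := by ring
  have hid : (1 / 2) * (2 * inner ℝ w wt) + μ * ‖w₁‖ ^ 2 =
      (μ * (inner ℝ w w₂ + inner ℝ w₁ w₁) + (k * u₃ * inner ℝ p₁ (Complex.I * p) +
        k * u₂ * (inner ℝ p₁ (Complex.I * p₁) + inner ℝ p₂ (Complex.I * p)))) +
      (-(k * u₃ * inner ℝ p₁ (Complex.I * p)) + -(k * inner ℝ w (Complex.I * θ))) := by
    rw [hwt, hp₂]
    simp only [← Complex.ofReal_pow, Complex.inner, Complex.sq_norm, Complex.normSq_apply,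
      Complex.add_re, Complex.add_im,
      Complex.sub_re, Complex.sub_im, Complex.neg_re, Complex.neg_im, Complex.mul_re,
      Complex.mul_im, Complex.I_re, Complex.I_im, Complex.ofReal_re, Complex.ofReal_im,
      Complex.conj_re, Complex.conj_im]
    ring
  linarith

theorem stmt_12 :
    ∃ C₀ : ℝ, 0 < C₀ ∧
    ∀ μ δ₀ δs : ℝ, μ ∈ Ioc (0:ℝ) 1 → δ₀ ∈ Ioo (0:ℝ) (1/2) → 0 < δs →
    ∀ k : ℤ, k ≠ 0 →
    ∀ U : ℝ → ℝ → ℝ, ContDiff ℝ (⊤ : ℕ∞) (Function.uncurry U) →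
    (∀ t ≥ (0:ℝ), ∀ y ∈ Icc (-1:ℝ) 1, |deriv (deriv (deriv (U t))) y| ≤ δ₀) →
    ∀ ω ψ θ : ℝ → ℝ → ℂ,
    ContDiff ℝ (⊤ : ℕ∞) (Function.uncurry ω) → ContDiff ℝ (⊤ : ℕ∞) (Function.uncurry ψ) →
    ContDiff ℝ (⊤ : ℕ∞) (Function.uncurry θ) →
    (∀ t ≥ (0:ℝ), ω t (-1) = 0 ∧ ω t 1 = 0 ∧ ψ t (-1) = 0 ∧ ψ t 1 = 0) →
    (∀ t ≥ (0:ℝ), ∀ y ∈ Icc (-1:ℝ) 1,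
      deriv (deriv (ψ t)) y - (k : ℂ)^2 * ψ t y = ω t y) →
    (∀ t ≥ (0:ℝ), ∀ y ∈ Icc (-1:ℝ) 1,
      deriv (fun s => ω s y) t + Complex.I * (k : ℂ) * (U t y : ℂ) * ω t y
        - Complex.I * (k : ℂ) * (Complex.ofReal (deriv (deriv (U t)) y)) * ψ t y
        - (μ : ℂ) * deriv (deriv (ω t)) y = -(Complex.I * (k : ℂ) * θ t y)) →
    ∀ t ≥ (0:ℝ), ∃ d : ℝ,
      HasDerivWithinAt (fun s => ∫ y in (-1:ℝ)..1, ‖ω s y‖^2) d (Ici 0) t ∧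
      (1/2) * d + μ * (∫ y in (-1:ℝ)..1, ‖deriv (ω t) y‖^2) ≤
        C₀ * δ₀ * |(k : ℝ)| * ((k : ℝ)^2 * (∫ y in (-1:ℝ)..1, ‖ψ t y‖^2)
            + (∫ y in (-1:ℝ)..1, ‖deriv (ψ t) y‖^2))
          + δs * μ ^ ((1:ℝ)/3) * |(k : ℝ)| ^ ((2:ℝ)/3) * (∫ y in (-1:ℝ)..1, ‖ω t y‖^2)
          + (1 / (4 * δs)) * μ ^ (-(1:ℝ)/3) * |(k : ℝ)| ^ ((4:ℝ)/3) *
              (∫ y in (-1:ℝ)..1, ‖θ t y‖^2) := by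
  refine ⟨1, one_pos, ?_⟩
  intro μ δ₀ δs hμ _ hδs k hk U hU hU₃ ω ψ θ hω hψ hθ hbc hpoisson hvort t ht
  have hk₀ : 0 < |(k : ℝ)| := abs_pos.2 (Int.cast_ne_zero.2 hk)
  have hk₁ : 1 ≤ (k : ℝ) ^ 2 := by
    exact_mod_cast Int.one_le_abs (pow_ne_zero 2 hk) |>.trans_eq (abs_of_nonneg (sq_nonneg k))
  have hμ₀ := hμ.1
  set A := δs * μ ^ ((1:ℝ)/3) * |(k : ℝ)| ^ ((2:ℝ)/3) with hA
  set B := (1 / (4 * δs)) * μ ^ (-(1:ℝ)/3) * |(k : ℝ)| ^ ((4:ℝ)/3) with hB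
  have hA₀ : 0 < A := by positivity
  have hAB : 4 * (A * B) = (k : ℝ) ^ 2 := by
    have h₁ : μ ^ ((1:ℝ)/3) * μ ^ (-(1:ℝ)/3) = 1 := by
      rw [← Real.rpow_add hμ₀]; norm_num
    have h₂ : |(k : ℝ)| ^ ((2:ℝ)/3) * |(k : ℝ)| ^ ((4:ℝ)/3) = (k : ℝ) ^ 2 := by
      rw [← Real.rpow_add hk₀, ← sq_abs, ← Real.rpow_natCast]; norm_num
    calc 4 * (A * B) = 4 * δs * (1 / (4 * δs)) * (μ ^ ((1:ℝ)/3) * μ ^ (-(1:ℝ)/3)) *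
          (|(k : ℝ)| ^ ((2:ℝ)/3) * |(k : ℝ)| ^ ((4:ℝ)/3)) := by rw [hA, hB]; ring
      _ = _ := by rw [h₁, h₂]; field_simp
  clear_value A B
  have hslice : ∀ {E : Type} [NormedAddCommGroup E] [NormedSpace ℝ E] {f : ℝ → ℝ → E},
      ContDiff ℝ (⊤ : ℕ∞) (Function.uncurry f) → ContDiff ℝ (⊤ : ℕ∞) (f t) := fun hf =>
    hf.comp (contDiff_prodMk_right t)
  have hasDeriv : ∀ {E : Type} [NormedAddCommGroup E] [NormedSpace ℝ E] {g : ℝ → E},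
      ContDiff ℝ (⊤ : ℕ∞) g → ∀ y, HasDerivAt g (deriv g y) y := fun hg y =>
    (hg.differentiable (by simp) y).hasDerivAt
  have hω₀ := hslice hω
  have hω₁ := (contDiff_infty_iff_deriv.1 hω₀).2
  have hω₂ := (contDiff_infty_iff_deriv.1 hω₁).2
  have hψ₀ := hslice hψ
  have hψ₁ := (contDiff_infty_iff_deriv.1 hψ₀).2
  have hψ₂ := (contDiff_infty_iff_deriv.1 hψ₁).2
  have hθ₀ := hslice hθ
  have hU₀' := hslice hU
  have hU₁' := (contDiff_infty_iff_deriv.1 hU₀').2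
  have hU₂' := (contDiff_infty_iff_deriv.1 hU₁').2
  have hU₃' := (contDiff_infty_iff_deriv.1 hU₂').2
  have cω₀ := hω₀.continuous
  have cω₁ := hω₁.continuous
  have cω₂ := hω₂.continuous
  have cψ₀ := hψ₀.continuous
  have cψ₁ := hψ₁.continuous
  have cψ₂ := hψ₂.continuous
  have cθ₀ := hθ₀.continuous
  have cU₂ := hU₂'.continuous
  have cU₃ := hU₃'.continuous
  have hωt : ∀ y, HasDerivAt (fun s => ω s y) (fderiv ℝ (Function.uncurry ω) (t, y) (1, 0)) t :=
    fun y => (hω.differentiable (by simp) (t, y)).hasDerivAt_uncurry_left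
  have cωt : Continuous fun y => deriv (fun s => ω s y) t := by
    simp_rw [fun y => (hωt y).deriv]
    exact ((hω.continuous_fderiv (by simp)).comp (.prodMk_right t)).clm_apply continuous_const
  have hsq : ∀ y, deriv (fun s => ‖ω s y‖ ^ 2) t =
      2 * inner ℝ (ω t y) (deriv (fun s => ω s y) t) := fun y =>
    ((hωt y).differentiableAt.hasDerivAt.norm_sq).deriv
  have henergy := hasDerivAt_intervalIntegral_of_contDiff (a := -1) (b := 1)
    (f := fun s y => ‖ω s y‖ ^ 2) ((hω.of_le (by simp)).norm_sq ℝ) t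
  simp_rw [hsq] at henergy
  refine ⟨_, henergy.hasDerivWithinAt, ?_⟩
  set F : ℝ → ℝ := fun y => μ * inner ℝ (ω t y) (deriv (ω t) y) +
    k * deriv (deriv (U t)) y * inner ℝ (deriv (ψ t) y) (Complex.I * ψ t y) with hF
  set F' : ℝ → ℝ := fun y =>
    μ * (inner ℝ (ω t y) (deriv (deriv (ω t)) y) + inner ℝ (deriv (ω t) y) (deriv (ω t) y)) +
    (k * deriv (deriv (deriv (U t))) y * inner ℝ (deriv (ψ t) y) (Complex.I * ψ t y) +
      k * deriv (deriv (U t)) y * (inner ℝ (deriv (ψ t) y) (Complex.I * deriv (ψ t) y) +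
        inner ℝ (deriv (deriv (ψ t)) y) (Complex.I * ψ t y))) with hF'
  have hFF' : ∀ y, HasDerivAt F (F' y) y := fun y =>
    (((hasDeriv hω₀ y).inner ℝ (hasDeriv hω₁ y)).const_mul μ).add
      (((hasDeriv hU₂' y).const_mul (k : ℝ)).mul
        ((hasDeriv hψ₁ y).inner ℝ ((hasDeriv hψ₀ y).const_mul Complex.I)))
  have cF' : Continuous F' := by fun_prop
  have hF₀ : ∫ y in (-1:ℝ)..1, F' y = 0 := by
    rw [intervalIntegral.integral_eq_sub_of_hasDerivAt (fun y _ => hFF' y)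
      (cF'.intervalIntegrable _ _)]
    obtain ⟨h₁, h₂, h₃, h₄⟩ := hbc t ht
    simp [hF, h₁, h₂, h₃, h₄]
  have hmono := intervalIntegral.integral_mono_on (μ := MeasureTheory.volume)
    (a := -1) (b := 1) (by norm_num)
    (f := fun y => (1 / 2) * (2 * inner ℝ (ω t y) (deriv (fun s => ω s y) t)) +
      μ * ‖deriv (ω t) y‖ ^ 2)
    (g := fun y => F' y + (1 * δ₀ * |(k : ℝ)| * ((k : ℝ) ^ 2 * ‖ψ t y‖ ^ 2 +
      ‖deriv (ψ t) y‖ ^ 2) + A * ‖ω t y‖ ^ 2 + B * ‖θ t y‖ ^ 2))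
    (Continuous.intervalIntegrable (by fun_prop) _ _)
    (Continuous.intervalIntegrable (by fun_prop) _ _)
    (fun y hy => vorticity_energy_pointwise hA₀ hAB hk₁ (hU₃ t ht y hy)
      (by exact_mod_cast hpoisson t ht y hy) (by exact_mod_cast hvort t ht y hy))
  have hint : ∀ {g : ℝ → ℝ}, Continuous g →
      IntervalIntegrable g MeasureTheory.volume (-1) 1 := fun hg => hg.intervalIntegrable _ _
  rw [intervalIntegral.integral_add (hint (by fun_prop)) (hint (by fun_prop)),
    intervalIntegral.integral_add (hint cF') (hint (by fun_prop)), hF₀, zero_add,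
    intervalIntegral.integral_add (hint (by fun_prop)) (hint (by fun_prop)),
    intervalIntegral.integral_add (hint (by fun_prop)) (hint (by fun_prop))] at hmono
  simp only [intervalIntegral.integral_const_mul] at hmono
  rw [intervalIntegral.integral_add (hint (by fun_prop)) (hint (by fun_prop))] at hmono
  simpa only [intervalIntegral.integral_const_mul] using hmono
end

section
/- There exists a constant C₀ > 0 such that the following holds. Let μ ∈ (0,1], δ₀ ∈ (0,1/2), and let k be a nonzero integer. Let U : [0,∞) × [-1,1] → ℝ be smooth with |∂_y U(t,y) - 1| ≤ δ₀, |∂_y² U(t,y)| ≤ δ₀ and |∂_y³ U(t,y)| ≤ δ₀ for all t ≥ 0, y ∈ [-1,1]. Let ω, ψ, θ : [0,∞) × [-1,1] → ℂ be smooth with ω(t,±1) = 0 and ψ(t,±1) = 0 for all t ≥ 0, satisfying ∂_y² ψ - k²·ψ = ω and ∂_t ω + i·k·U·ω - i·k·(∂_y² U)·ψ - μ·∂_y² ω = -i·k·θ on [0,∞) × [-1,1]. Then for every t ≥ 0: μ^{1/3}·|k|^{-4/3}·(d/dt)[Re⟨i·k·ω(t,·), ∂_y ω(t,·)⟩] +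 μ^{1/3}·|k|^{2/3}·∫_{-1}^{1} ∂_y U(t,y)·|ω(t,y)|² dy ≤ (3/2)·μ·‖∂_y ω(t,·)‖²_{L²} + μ^{5/3}·|k|^{-2/3}·‖∂_y² ω(t,·)‖²_{L²} + C₀·δ₀·μ^{1/3}·|k|^{2/3}·‖ω(t,·)‖²_{L²} + C₀·μ^{-1/3}·|k|^{4/3}·‖θ(t,·)‖²_{L²}. -/
open Set ComplexConjugate

section PartialDerivatives

variable {E : Type*} [NormedAddCommGroup E] [NormedSpace ℝ E] {f : ℝ → ℝ → E}

theorem hasDerivAt_left_of_contDiff_uncurry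
    (hf : ContDiff ℝ (⊤ : ℕ∞) (Function.uncurry f)) (t y : ℝ) :
    HasDerivAt (fun s => f s y) (fderiv ℝ (Function.uncurry f) (t, y) (1, 0)) t :=
  HasFDerivAt.comp_hasDerivAt (f := fun s : ℝ => (s, y)) t
    (hf.differentiable (by simp) (t, y)).hasFDerivAt
    ((hasDerivAt_id t).prodMk (hasDerivAt_const t y))

theorem hasDerivAt_right_of_contDiff_uncurry
    (hf : ContDiff ℝ (⊤ : ℕ∞) (Function.uncurry f)) (t y : ℝ) :
    HasDerivAt (f t) (fderiv ℝ (Function.uncurry f) (t, y) (0, 1)) y :=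
  HasFDerivAt.comp_hasDerivAt (f := fun z : ℝ => (t, z)) y
    (hf.differentiable (by simp) (t, y)).hasFDerivAt
    ((hasDerivAt_const y t).prodMk (hasDerivAt_id y))

theorem contDiff_fderiv_apply_of_contDiff_top {F : Type*} [NormedAddCommGroup F]
    [NormedSpace ℝ F] {g : F → E} (hg : ContDiff ℝ (⊤ : ℕ∞) g) (v : F) :
    ContDiff ℝ (⊤ : ℕ∞) (fun p => fderiv ℝ g p v) :=
  (hg.fderiv_right (by simp)).clm_apply contDiff_const

theorem contDiff_uncurry_deriv_left (hf : ContDiff ℝ (⊤ : ℕ∞) (Function.uncurry f)) :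
    ContDiff ℝ (⊤ : ℕ∞) (Function.uncurry fun t y => deriv (fun s => f s y) t) := by
  convert contDiff_fderiv_apply_of_contDiff_top hf (1, 0) using 1
  ext ⟨t, y⟩
  exact (hasDerivAt_left_of_contDiff_uncurry hf t y).deriv

theorem contDiff_uncurry_deriv_right (hf : ContDiff ℝ (⊤ : ℕ∞) (Function.uncurry f)) :
    ContDiff ℝ (⊤ : ℕ∞) (Function.uncurry fun t y => deriv (f t) y) := by
  convert contDiff_fderiv_apply_of_contDiff_top hf (0, 1) using 1
  ext ⟨t, y⟩
  exact (hasDerivAt_right_of_contDiff_uncurry hf t y).deriv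

theorem deriv_deriv_comm_of_contDiff_uncurry
    (hf : ContDiff ℝ (⊤ : ℕ∞) (Function.uncurry f)) (t y : ℝ) :
    deriv (fun s => deriv (f s) y) t = deriv (fun z => deriv (fun s => f s z) t) y := by
  have hd : DifferentiableAt ℝ (fderiv ℝ (Function.uncurry f)) (t, y) :=
    (hf.fderiv_right (m := 1) (by norm_cast)).differentiable (by simp) _
  have hsymm : IsSymmSndFDerivAt ℝ (Function.uncurry f) (t, y) :=
    hf.contDiffAt.isSymmSndFDerivAt (by simp; norm_cast)
  have e₁ := (hasDerivAt_left_of_contDiff_uncurry (contDiff_uncurry_deriv_right hf) t y).deriv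
  have e₂ := (hasDerivAt_right_of_contDiff_uncurry (contDiff_uncurry_deriv_left hf) t y).deriv
  have h₁ : (Function.uncurry fun t y => deriv (f t) y) =
      fun p => fderiv ℝ (Function.uncurry f) p (0, 1) := by
    ext ⟨t, y⟩
    exact (hasDerivAt_right_of_contDiff_uncurry hf t y).deriv
  have h₂ : (Function.uncurry fun t y => deriv (fun s => f s y) t) =
      fun p => fderiv ℝ (Function.uncurry f) p (1, 0) := by
    ext ⟨t, y⟩
    exact (hasDerivAt_left_of_contDiff_uncurry hf t y).deriv
  rw [e₁, e₂, h₁, h₂, fderiv_clm_apply hd (by fun_prop), fderiv_clm_apply hd (by fun_prop)]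
  simpa using hsymm.eq (1, 0) (0, 1)

/-- Differentiation under the integral sign for smooth integrands on a compact interval. -/
theorem hasDerivAt_intervalIntegral_of_contDiff_uncurry
    (hf : ContDiff ℝ (⊤ : ℕ∞) (Function.uncurry f)) (a b t : ℝ) :
    HasDerivAt (fun s => ∫ y in a..b, f s y) (∫ y in a..b, deriv (fun s => f s y) t) t := by
  have hc := (contDiff_uncurry_deriv_left hf).continuous
  obtain ⟨C, hC⟩ := ((isCompact_closedBall t 1).prod
    (isCompact_uIcc (a := a) (b := b))).exists_bound_of_continuousOn hc.continuousOn
  have hcont : ∀ s, Continuous (f s) := fun s =>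
    hf.continuous.comp (by fun_prop : Continuous fun y : ℝ => (s, y))
  have hcont' : Continuous fun y => deriv (fun s => f s y) t :=
    hc.comp (by fun_prop : Continuous fun y : ℝ => (t, y))
  refine (intervalIntegral.hasDerivAt_integral_of_dominated_loc_of_deriv_le
    (F' := fun s y => deriv (fun s => f s y) s) (bound := fun _ => C)
    (Metric.closedBall_mem_nhds t one_pos)
    (.of_forall fun s => (hcont s).aestronglyMeasurable) ((hcont t).intervalIntegrable a b)
    hcont'.aestronglyMeasurable ?_ intervalIntegrable_const ?_).2
  · exact .of_forall fun y hy s hs => hC (s, y) ⟨hs, uIoc_subset_uIcc hy⟩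
  · exact .of_forall fun y _ s _ =>
      (hasDerivAt_left_of_contDiff_uncurry hf s y).differentiableAt.hasDerivAt

end PartialDerivatives

theorem two_mul_re_mul_conj_le (r : ℝ) (z w : ℂ) :
    2 * r * (z * conj w).re ≤ r ^ 2 * ‖z‖ ^ 2 + ‖w‖ ^ 2 := by
  simp only [← Complex.normSq_eq_norm_sq, Complex.normSq_apply, Complex.mul_re, Complex.conj_re,
    Complex.conj_im]
  nlinarith [sq_nonneg (r * z.re - w.re), sq_nonneg (r * z.im - w.im)]

theorem two_mul_re_ofReal_mul_mul_conj_le {u δ : ℝ} (hu : |u| ≤ δ) (z w : ℂ) :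
    2 * ((u : ℂ) * z * conj w).re ≤ δ * (‖z‖ ^ 2 + ‖w‖ ^ 2) := by
  have h₁ := two_mul_re_mul_conj_le 1 z w
  have h₂ := two_mul_re_mul_conj_le (-1) z w
  have h₃ := abs_le.1 hu
  have : ((u : ℂ) * z * conj w).re = u * (z * conj w).re := by
    rw [mul_assoc, Complex.re_ofReal_mul]
  rw [this]
  rcases le_total 0 (z * conj w).re with h | h <;>
    nlinarith [sq_nonneg ‖z‖, sq_nonneg ‖w‖, (abs_nonneg u).trans hu]

/-- The pointwise form of the energy inequality: up to the derivative of a quantity vanishing at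
the boundary, the integrands satisfy the claimed estimate. -/
theorem energy_density_le {m κ δ k u u₁ u₂ u₃ : ℝ} {w w₁ w₂ wt wt₁ p p₁ p₂ θ : ℂ}
    (hm : 0 < m) (hκ : 0 < κ) (hk : |k| = κ ^ 3) (hk1 : 1 ≤ |k|) (hδ : 0 < δ)
    (hu₂ : |u₂| ≤ δ) (hu₃ : |u₃| ≤ δ)
    (hp : p₂ - (k : ℂ) ^ 2 * p = w)
    (hw : wt + Complex.I * k * u * w - Complex.I * k * u₂ * p - ((m ^ 3 : ℝ) : ℂ) * w₂ =
      -(Complex.I * k * θ)) :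
    m / κ ^ 4 * (Complex.I * k * wt * conj w₁ + Complex.I * k * w * conj wt₁).re
        + m * κ ^ 2 * (u₁ * ‖w‖ ^ 2) ≤
      3 / 2 * m ^ 3 * ‖w₁‖ ^ 2 + m ^ 5 / κ ^ 2 * ‖w₂‖ ^ 2 + 4 * δ * m * κ ^ 2 * ‖w‖ ^ 2
        + 4 * (κ ^ 4 / m) * ‖θ‖ ^ 2
        + (m / κ ^ 4 * (Complex.I * k * (w₁ * conj wt + w * conj wt₁)
            + (k : ℂ) ^ 2 * (u₁ * (w * conj w) + u * (w₁ * conj w + w * conj w₁))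
            - 2 * (k : ℂ) ^ 2 * (u₃ * (p * conj w) + u₂ * (p₁ * conj w + p * conj w₁))
            + 2 * (k : ℂ) ^ 2 * δ * (p₂ * conj p + p₁ * conj p₁))).re := by
  have hk2 : k ^ 2 = κ ^ 6 := by rw [← sq_abs, hk]; ring
  have hk2' : 1 ≤ k ^ 2 := by rw [← sq_abs]; nlinarith
  have hident : (Complex.I * k * wt * conj w₁ + Complex.I * k * w * conj wt₁).re
        + k ^ 2 * (u₁ * ‖w‖ ^ 2) =
      (Complex.I * k * (w₁ * conj wt + w * conj wt₁)
            + (k : ℂ) ^ 2 * (u₁ * (w * conj w) + u * (w₁ * conj w + w * conj w₁))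
            - 2 * (k : ℂ) ^ 2 * (u₃ * (p * conj w) + u₂ * (p₁ * conj w + p * conj w₁))).re
        + k ^ 2 * (2 * (u₃ * p * conj w).re + 2 * (u₂ * p₁ * conj w).re)
        + 2 * k * m ^ 3 * (Complex.I * w₂ * conj w₁).re
        + 2 * k ^ 2 * (θ * conj w₁).re := by
    have hwt : wt = -(Complex.I * k * u * w) + Complex.I * k * u₂ * p + ((m ^ 3 : ℝ) : ℂ) * w₂
        - Complex.I * k * θ := by linear_combination hw
    rw [hwt, ← Complex.normSq_eq_norm_sq, Complex.normSq_apply]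
    simp [← Complex.ofReal_pow]
    ring
  have hell : ‖p‖ ^ 2 + ‖p₁‖ ^ 2 ≤ 2 * (p₂ * conj p + p₁ * conj p₁).re + ‖w‖ ^ 2 := by
    have h := two_mul_re_mul_conj_le (-1) w p
    have e : (p₂ * conj p + p₁ * conj p₁).re = k ^ 2 * ‖p‖ ^ 2 + (w * conj p).re + ‖p₁‖ ^ 2 := by
      have hp₂ : p₂ = (k : ℂ) ^ 2 * p + w := by linear_combination hp
      rw [hp₂, ← Complex.normSq_eq_norm_sq, Complex.normSq_apply, ← Complex.normSq_eq_norm_sq,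
        Complex.normSq_apply]
      simp [← Complex.ofReal_pow]
      ring
    rw [e]
    nlinarith [sq_nonneg ‖p‖, sq_nonneg ‖p₁‖]
  have hdiff : m / κ ^ 4 * (2 * k * m ^ 3 * (Complex.I * w₂ * conj w₁).re) ≤
      m ^ 3 * ‖w₁‖ ^ 2 + m ^ 5 / κ ^ 2 * ‖w₂‖ ^ 2 := by
    have h := mul_le_mul_of_nonneg_left
      (two_mul_re_mul_conj_le (m * k / κ ^ 4) (Complex.I * w₂) w₁) (pow_pos hm 3).le
    rw [norm_mul, Complex.norm_I, one_mul] at h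
    calc _ = m ^ 3 * (2 * (m * k / κ ^ 4) * (Complex.I * w₂ * conj w₁).re) := by ring
      _ ≤ _ := h
      _ = _ := by rw [div_pow, mul_pow, hk2]; field_simp; ring
  have hforce : m / κ ^ 4 * (2 * k ^ 2 * (θ * conj w₁).re) ≤
      1 / 2 * m ^ 3 * ‖w₁‖ ^ 2 + 4 * (κ ^ 4 / m) * ‖θ‖ ^ 2 := by
    have h := mul_le_mul_of_nonneg_left
      (two_mul_re_mul_conj_le (2 * κ ^ 2 / m ^ 2) θ w₁) (pow_pos hm 3).le
    have e₁ : m / κ ^ 4 * (2 * k ^ 2 * (θ * conj w₁).re) =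
      1 / 2 * (m ^ 3 * (2 * (2 * κ ^ 2 / m ^ 2) * (θ * conj w₁).re)) := by
      rw [hk2]; field_simp
    have e₂ : m ^ 3 * ((2 * κ ^ 2 / m ^ 2) ^ 2 * ‖θ‖ ^ 2 + ‖w₁‖ ^ 2) =
      m ^ 3 * ‖w₁‖ ^ 2 + 4 * (κ ^ 4 / m * ‖θ‖ ^ 2) := by
      field_simp; ring
    have : 0 ≤ κ ^ 4 / m * ‖θ‖ ^ 2 := by positivity
    rw [e₁]
    linarith
  have hnonlocal : m / κ ^ 4 * (k ^ 2 * (2 * (u₃ * p * conj w).re + 2 * (u₂ * p₁ * conj w).re)) ≤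
      m * κ ^ 2 * (δ * (2 * (p₂ * conj p + p₁ * conj p₁).re + 3 * ‖w‖ ^ 2)) := by
    have h : 2 * (u₃ * p * conj w).re + 2 * (u₂ * p₁ * conj w).re ≤
        δ * (2 * (p₂ * conj p + p₁ * conj p₁).re + 3 * ‖w‖ ^ 2) := by
      have h₁ := two_mul_re_ofReal_mul_mul_conj_le hu₃ p w
      have h₂ := two_mul_re_ofReal_mul_mul_conj_le hu₂ p₁ w
      have h₃ := mul_le_mul_of_nonneg_left hell hδ.le
      linarith
    calc _ = m * κ ^ 2 * (2 * (u₃ * p * conj w).re + 2 * (u₂ * p₁ * conj w).re) := by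
          rw [hk2]; field_simp
      _ ≤ _ := by gcongr
  have hA : m * κ ^ 2 = m / κ ^ 4 * k ^ 2 := by rw [hk2]; field_simp
  have hsplit : ∀ z q : ℂ, (m / κ ^ 4 * (z + 2 * (k : ℂ) ^ 2 * δ * q)).re =
      m / κ ^ 4 * z.re + m * κ ^ 2 * (δ * (2 * q.re)) := by
    intro z q
    have : (m / κ ^ 4 * (z + 2 * (k : ℂ) ^ 2 * δ * q) : ℂ) =
        ((m / κ ^ 4 : ℝ) : ℂ) * (z + ((2 * k ^ 2 * δ : ℝ) : ℂ) * q) := by push_cast; ring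
    rw [this, Complex.re_ofReal_mul, Complex.add_re, Complex.re_ofReal_mul, hA]
    ring
  have hw0 : 0 ≤ m * κ ^ 2 * (δ * ‖w‖ ^ 2) := by positivity
  have hmul := congrArg (fun x => m / κ ^ 4 * x) hident
  simp only [mul_add] at hmul hnonlocal hdiff hforce
  rw [hsplit]
  rw [← mul_assoc (m / κ ^ 4) (k ^ 2), ← hA] at hmul
  simp only [mul_add] at *
  linarith

/-- The energy inequality at a fixed time, in terms of `m = μ ^ (1/3)` and `κ = |k| ^ (1/3)`. -/
theorem energy_integral_le {m κ δ k : ℝ} {u u₁ u₂ u₃ : ℝ → ℝ}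
    {w w₁ w₂ wt wt₁ p p₁ p₂ θ : ℝ → ℂ}
    (hm : 0 < m) (hκ : 0 < κ) (hk : |k| = κ ^ 3) (hk1 : 1 ≤ |k|) (hδ : 0 < δ)
    (du : ∀ y, HasDerivAt u (u₁ y) y) (du₂ : ∀ y, HasDerivAt u₂ (u₃ y) y)
    (dw : ∀ y, HasDerivAt w (w₁ y) y) (dwt : ∀ y, HasDerivAt wt (wt₁ y) y)
    (dp : ∀ y, HasDerivAt p (p₁ y) y) (dp₁ : ∀ y, HasDerivAt p₁ (p₂ y) y)
    (cu₁ : Continuous u₁) (cu₃ : Continuous u₃) (cw₁ : Continuous w₁) (cw₂ : Continuous w₂)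
    (cwt₁ : Continuous wt₁) (cp₂ : Continuous p₂) (cθ : Continuous θ)
    (hu₂ : ∀ y ∈ Icc (-1 : ℝ) 1, |u₂ y| ≤ δ) (hu₃ : ∀ y ∈ Icc (-1 : ℝ) 1, |u₃ y| ≤ δ)
    (hw_left : w (-1) = 0) (hw_right : w 1 = 0) (hp_left : p (-1) = 0) (hp_right : p 1 = 0)
    (hp : ∀ y ∈ Icc (-1 : ℝ) 1, p₂ y - (k : ℂ) ^ 2 * p y = w y)
    (hw : ∀ y ∈ Icc (-1 : ℝ) 1, wt y + Complex.I * k * u y * w y - Complex.I * k * u₂ y * p y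
      - ((m ^ 3 : ℝ) : ℂ) * w₂ y = -(Complex.I * k * θ y)) :
    m / κ ^ 4 * (∫ y in (-1 : ℝ)..1,
          (Complex.I * k * wt y * conj (w₁ y) + Complex.I * k * w y * conj (wt₁ y))).re
        + m * κ ^ 2 * (∫ y in (-1 : ℝ)..1, u₁ y * ‖w y‖ ^ 2) ≤
      3 / 2 * m ^ 3 * (∫ y in (-1 : ℝ)..1, ‖w₁ y‖ ^ 2)
        + m ^ 5 / κ ^ 2 * (∫ y in (-1 : ℝ)..1, ‖w₂ y‖ ^ 2)
        + 4 * δ * m * κ ^ 2 * (∫ y in (-1 : ℝ)..1, ‖w y‖ ^ 2)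
        + 4 * (κ ^ 4 / m) * (∫ y in (-1 : ℝ)..1, ‖θ y‖ ^ 2) := by
  have cu : Continuous u := continuous_iff_continuousAt.2 fun y => (du y).continuousAt
  have cu₂ : Continuous u₂ := continuous_iff_continuousAt.2 fun y => (du₂ y).continuousAt
  have cw : Continuous w := continuous_iff_continuousAt.2 fun y => (dw y).continuousAt
  have cwt : Continuous wt := continuous_iff_continuousAt.2 fun y => (dwt y).continuousAt
  have cp : Continuous p := continuous_iff_continuousAt.2 fun y => (dp y).continuousAt
  have cp₁ : Continuous p₁ := continuous_iff_continuousAt.2 fun y => (dp₁ y).continuousAt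
  set B : ℝ → ℂ := fun y => m / κ ^ 4 * (Complex.I * k * (w y * conj (wt y))
    + (k : ℂ) ^ 2 * (u y * (w y * conj (w y))) - 2 * (k : ℂ) ^ 2 * (u₂ y * (p y * conj (w y)))
    + 2 * (k : ℂ) ^ 2 * δ * (p₁ y * conj (p y))) with hB
  set B' : ℝ → ℂ := fun y => m / κ ^ 4 *
    (Complex.I * k * (w₁ y * conj (wt y) + w y * conj (wt₁ y))
      + (k : ℂ) ^ 2 * (u₁ y * (w y * conj (w y))
        + u y * (w₁ y * conj (w y) + w y * conj (w₁ y)))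
      - 2 * (k : ℂ) ^ 2 * (u₃ y * (p y * conj (w y))
        + u₂ y * (p₁ y * conj (w y) + p y * conj (w₁ y)))
      + 2 * (k : ℂ) ^ 2 * δ * (p₂ y * conj (p y) + p₁ y * conj (p₁ y)))
  have cB' : Continuous fun y => (B' y).re := by fun_prop
  have dB : ∀ y, HasDerivAt (fun z => (B z).re) (B' y).re y := by
    intro y
    have conj_deriv : ∀ {f : ℝ → ℂ} {f' : ℂ}, HasDerivAt f f' y →
        HasDerivAt (fun z => conj (f z)) (conj f') y := fun h => h.star
    have h : HasDerivAt B (B' y) y :=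
      ((((((dw y).mul (conj_deriv (dwt y))).const_mul _).add
        (((du y).ofReal_comp.mul ((dw y).mul (conj_deriv (dw y)))).const_mul _)).sub
        (((du₂ y).ofReal_comp.mul ((dp y).mul (conj_deriv (dw y)))).const_mul _)).add
        (((dp₁ y).mul (conj_deriv (dp y))).const_mul _)).const_mul _
    exact Complex.reCLM.hasFDerivAt.comp_hasDerivAt y h
  have hBint : ∫ y in (-1 : ℝ)..1, (B' y).re = 0 := by
    rw [intervalIntegral.integral_eq_sub_of_hasDerivAt (fun y _ => dB y)
      (cB'.intervalIntegrable _ _)]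
    simp [hB, hw_left, hw_right, hp_left, hp_right]
  have hre : (∫ y in (-1 : ℝ)..1,
        (Complex.I * k * wt y * conj (w₁ y) + Complex.I * k * w y * conj (wt₁ y))).re =
      ∫ y in (-1 : ℝ)..1,
        (Complex.I * k * wt y * conj (w₁ y) + Complex.I * k * w y * conj (wt₁ y)).re :=
    (Complex.reCLM.intervalIntegral_comp_comm
      (Continuous.intervalIntegrable (by fun_prop) _ _)).symm
  have hmono := intervalIntegral.integral_mono_on (μ := MeasureTheory.volume)
    (by norm_num : (-1 : ℝ) ≤ 1)
    (Continuous.intervalIntegrable (by fun_prop) _ _)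
    (Continuous.intervalIntegrable (by fun_prop) _ _)
    fun y hy => energy_density_le (u₁ := u₁ y) (w₁ := w₁ y) (wt₁ := wt₁ y) (p₁ := p₁ y) hm hκ hk hk1
      hδ (hu₂ y hy) (hu₃ y hy) (hp y hy) (hw y hy)
  rw [intervalIntegral.integral_add (Continuous.intervalIntegrable (by fun_prop) _ _)
      (Continuous.intervalIntegrable (by fun_prop) _ _),
    intervalIntegral.integral_add (Continuous.intervalIntegrable (by fun_prop) _ _)
      (Continuous.intervalIntegrable (by fun_prop) _ _),
    intervalIntegral.integral_add (Continuous.intervalIntegrable (by fun_prop) _ _)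
      (Continuous.intervalIntegrable (by fun_prop) _ _),
    intervalIntegral.integral_add (Continuous.intervalIntegrable (by fun_prop) _ _)
      (Continuous.intervalIntegrable (by fun_prop) _ _),
    intervalIntegral.integral_add (Continuous.intervalIntegrable (by fun_prop) _ _)
      (Continuous.intervalIntegrable (by fun_prop) _ _)] at hmono
  simp only [intervalIntegral.integral_const_mul] at hmono
  rw [hBint, add_zero] at hmono
  rw [hre]
  exact hmono

theorem stmt_14 :
    ∃ C₀ : ℝ, 0 < C₀ ∧
    ∀ μ δ₀ : ℝ, μ ∈ Ioc (0:ℝ) 1 → δ₀ ∈ Ioo (0:ℝ) (1/2) →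
    ∀ k : ℤ, k ≠ 0 →
    ∀ U : ℝ → ℝ → ℝ, ContDiff ℝ (⊤ : ℕ∞) (Function.uncurry U) →
    (∀ t ≥ (0:ℝ), ∀ y ∈ Icc (-1:ℝ) 1, |deriv (U t) y - 1| ≤ δ₀) →
    (∀ t ≥ (0:ℝ), ∀ y ∈ Icc (-1:ℝ) 1, |deriv (deriv (U t)) y| ≤ δ₀) →
    (∀ t ≥ (0:ℝ), ∀ y ∈ Icc (-1:ℝ) 1, |deriv (deriv (deriv (U t))) y| ≤ δ₀) →
    ∀ ω ψ θ : ℝ → ℝ → ℂ,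
    ContDiff ℝ (⊤ : ℕ∞) (Function.uncurry ω) → ContDiff ℝ (⊤ : ℕ∞) (Function.uncurry ψ) →
    ContDiff ℝ (⊤ : ℕ∞) (Function.uncurry θ) →
    (∀ t ≥ (0:ℝ), ω t (-1) = 0 ∧ ω t 1 = 0 ∧ ψ t (-1) = 0 ∧ ψ t 1 = 0) →
    (∀ t ≥ (0:ℝ), ∀ y ∈ Icc (-1:ℝ) 1,
      deriv (deriv (ψ t)) y - (k : ℂ)^2 * ψ t y = ω t y) →
    (∀ t ≥ (0:ℝ), ∀ y ∈ Icc (-1:ℝ) 1,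
      deriv (fun s => ω s y) t + Complex.I * (k : ℂ) * (U t y : ℂ) * ω t y
        - Complex.I * (k : ℂ) * (Complex.ofReal (deriv (deriv (U t)) y)) * ψ t y
        - (μ : ℂ) * deriv (deriv (ω t)) y = -(Complex.I * (k : ℂ) * θ t y)) →
    ∀ t ≥ (0:ℝ), ∃ d : ℝ,
      HasDerivWithinAt (fun s => (∫ y in (-1:ℝ)..1,
          Complex.I * (k : ℂ) * ω s y * (starRingEnd ℂ) (deriv (ω s) y)).re)
        d (Ici 0) t ∧
      μ ^ ((1:ℝ)/3) * |(k : ℝ)| ^ (-(4:ℝ)/3) * d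
          + μ ^ ((1:ℝ)/3) * |(k : ℝ)| ^ ((2:ℝ)/3) *
              (∫ y in (-1:ℝ)..1, deriv (U t) y * ‖ω t y‖^2) ≤
        (3/2) * μ * (∫ y in (-1:ℝ)..1, ‖deriv (ω t) y‖^2)
          + μ ^ ((5:ℝ)/3) * |(k : ℝ)| ^ (-(2:ℝ)/3) *
              (∫ y in (-1:ℝ)..1, ‖deriv (deriv (ω t)) y‖^2)
          + C₀ * δ₀ * μ ^ ((1:ℝ)/3) * |(k : ℝ)| ^ ((2:ℝ)/3) *
              (∫ y in (-1:ℝ)..1, ‖ω t y‖^2)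
          + C₀ * μ ^ (-(1:ℝ)/3) * |(k : ℝ)| ^ ((4:ℝ)/3) *
              (∫ y in (-1:ℝ)..1, ‖θ t y‖^2) := by
  refine ⟨4, by norm_num, ?_⟩
  intro μ δ hμ hδ k hk U hU _ hU₂ hU₃ ω ψ θ hω hψ hθ hbd hell hevol t ht
  have slice : ∀ {E : Type} [NormedAddCommGroup E] [NormedSpace ℝ E] {f : ℝ → ℝ → E},
      ContDiff ℝ (⊤ : ℕ∞) (Function.uncurry f) → Continuous (f t) := fun hf =>
    hf.continuous.comp (by fun_prop : Continuous fun y : ℝ => (t, y))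
  have dslice : ∀ {E : Type} [NormedAddCommGroup E] [NormedSpace ℝ E] {f : ℝ → ℝ → E},
      ContDiff ℝ (⊤ : ℕ∞) (Function.uncurry f) → ∀ y, HasDerivAt (f t) (deriv (f t) y) y :=
    fun hf y => (hasDerivAt_right_of_contDiff_uncurry hf t y).differentiableAt.hasDerivAt
  have hω₁ := contDiff_uncurry_deriv_right hω
  have hω₂ := contDiff_uncurry_deriv_right hω₁
  have hωt := contDiff_uncurry_deriv_left hω
  have hωt₁ := contDiff_uncurry_deriv_right hωt
  have hψ₁ := contDiff_uncurry_deriv_right hψ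
  have hψ₂ := contDiff_uncurry_deriv_right hψ₁
  have hU₁' := contDiff_uncurry_deriv_right hU
  have hU₂' := contDiff_uncurry_deriv_right hU₁'
  have hU₃' := contDiff_uncurry_deriv_right hU₂'
  have hμ0 : 0 < μ := hμ.1
  have hk0 : 0 < |(k : ℝ)| := by positivity
  have hk1 : 1 ≤ |(k : ℝ)| := by exact_mod_cast Int.one_le_abs hk
  have cube : ∀ {x : ℝ}, 0 < x → ∀ n : ℕ, (x ^ ((1 : ℝ) / 3)) ^ n = x ^ ((n : ℝ) / 3) := by
    intro x hx n
    rw [← Real.rpow_natCast, ← Real.rpow_mul hx.le]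
    congr 1
    ring
  have hm : 0 < μ ^ ((1 : ℝ) / 3) := by positivity
  have hκ : 0 < |(k : ℝ)| ^ ((1 : ℝ) / 3) := by positivity
  have hm3 : (μ ^ ((1 : ℝ) / 3)) ^ 3 = μ := by rw [cube hμ0]; norm_num
  have hκ3 : |(k : ℝ)| = (|(k : ℝ)| ^ ((1 : ℝ) / 3)) ^ 3 := by rw [cube hk0]; norm_num
  have hsmooth : ContDiff ℝ (⊤ : ℕ∞) (Function.uncurry fun s y =>
      Complex.I * (k : ℂ) * ω s y * conj (deriv (ω s) y)) :=
    (contDiff_const.mul hω).mul (Complex.conjCLE.contDiff.comp hω₁)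
  have hderiv := hasDerivAt_intervalIntegral_of_contDiff_uncurry hsmooth (-1) 1 t
  have hintegrand : ∀ y, deriv (fun s => Complex.I * (k : ℂ) * ω s y * conj (deriv (ω s) y)) t =
      Complex.I * (k : ℝ) * deriv (fun s => ω s y) t * conj (deriv (ω t) y)
        + Complex.I * (k : ℝ) * ω t y * conj (deriv (fun z => deriv (fun s => ω s z) t) y) := by
    intro y
    rw [← deriv_deriv_comm_of_contDiff_uncurry hω]
    have h₁ := (hasDerivAt_left_of_contDiff_uncurry hω t y).differentiableAt.hasDerivAt
    have h₂ : HasDerivAt (fun s => conj (deriv (ω s) y))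
        (conj (deriv (fun s => deriv (ω s) y) t)) t :=
      (hasDerivAt_left_of_contDiff_uncurry hω₁ t y).differentiableAt.hasDerivAt.star
    rw [Complex.ofReal_intCast]
    exact ((h₁.const_mul (Complex.I * (k : ℂ))).mul h₂).deriv
  simp only [hintegrand] at hderiv
  refine ⟨_, (Complex.reCLM.hasFDerivAt.comp_hasDerivAt t hderiv).hasDerivWithinAt, ?_⟩
  obtain ⟨hω_left, hω_right, hψ_left, hψ_right⟩ := hbd t ht
  have key := energy_integral_le hm hκ hκ3 hk1 hδ.1 (dslice hU) (dslice hU₂') (dslice hω)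
    (dslice hωt) (dslice hψ) (dslice hψ₁) (slice hU₁') (slice hU₃') (slice hω₁) (slice hω₂)
    (slice hωt₁) (slice hψ₂) (slice hθ) (hU₂ t ht) (hU₃ t ht) hω_left hω_right hψ_left hψ_right
    (by simpa using hell t ht) (by simpa only [hm3, Complex.ofReal_intCast] using hevol t ht)
  have hk_neg_four : |(k : ℝ)| ^ (-(4 : ℝ) / 3) = ((|(k : ℝ)| ^ ((1 : ℝ) / 3)) ^ 4)⁻¹ := by
    rw [cube hk0, ← Real.rpow_neg hk0.le]; norm_num
  have hk_neg_two : |(k : ℝ)| ^ (-(2 : ℝ) / 3) = ((|(k : ℝ)| ^ ((1 : ℝ) / 3)) ^ 2)⁻¹ := by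
    rw [cube hk0, ← Real.rpow_neg hk0.le]; norm_num
  have hk_two : |(k : ℝ)| ^ ((2 : ℝ) / 3) = (|(k : ℝ)| ^ ((1 : ℝ) / 3)) ^ 2 := by
    rw [cube hk0]; norm_num
  have hk_four : |(k : ℝ)| ^ ((4 : ℝ) / 3) = (|(k : ℝ)| ^ ((1 : ℝ) / 3)) ^ 4 := by
    rw [cube hk0]; norm_num
  have hμ_five : μ ^ ((5 : ℝ) / 3) = (μ ^ ((1 : ℝ) / 3)) ^ 5 := by
    rw [cube hμ0]; norm_num
  have hμ_neg_one : μ ^ (-(1 : ℝ) / 3) = (μ ^ ((1 : ℝ) / 3))⁻¹ := by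
    rw [← Real.rpow_neg hμ0.le]; norm_num
  rw [hm3] at key
  rw [hk_neg_four, hk_neg_two, hk_two, hk_four, hμ_five, hμ_neg_one, Complex.reCLM_apply]
  exact key.trans_eq (by ring)
end
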